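/- arXiv:2209.14501 — 4 statements merged into one kernel-verified Lean document; each statement's English description precedes it below -/
import Mathlib

section
/- The following 2d vectors form an orthonormal basis of eigenvectors of H: for k = 1, …, d, the vector E_k := (1/√(2d)) Σ_{j=1}^d e^{2πi·kj/d} (e_{(j,+)} + e_{(j,−)}), which satisfies H E_k = (μ − 2w) E_k for k = 1, …, d−1 and H E_d = (μ + 2w(d−1)) E_d; and for k = d+1, …, 2d, the vector E_k := (1/√2)(e_{(k−d,+)} − e_{(k−d,−)}), which satisfies H E_k = μ E_k. (Eigendecomposition of the tensor-decomposition interaction matrix, Lemma 7.) -/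
/-- Sum over the `d`-th roots of unity: a character of `ℤ/dℤ` sums to `d` or `0`. -/
theorem sum_exp_two_pi_mul_int_div (d : ℕ) (hd : 1 ≤ d) (m : ℤ) :
    ∑ j : Fin d, Complex.exp (2 * Real.pi * Complex.I * m * ((j.1 : ℂ) + 1) / d)
      = if (d : ℤ) ∣ m then (d : ℂ) else 0 := by
  have hd0 : (d : ℂ) ≠ 0 := by exact_mod_cast (by omega : d ≠ 0)
  set z := Complex.exp (2 * Real.pi * Complex.I * m / d) with hz
  have hterm : ∀ j : ℕ,
      Complex.exp (2 * Real.pi * Complex.I * m * ((j : ℂ) + 1) / d) = z * z ^ j := by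
    intro j
    rw [hz, ← Complex.exp_nat_mul, ← Complex.exp_add]
    congr 1
    ring
  have hpow : z ^ d = 1 := by
    rw [hz, ← Complex.exp_nat_mul, Complex.exp_eq_one_iff]
    exact ⟨m, by field_simp⟩
  simp only [hterm]
  rw [← Finset.mul_sum, Fin.sum_univ_eq_sum_range (fun j => z ^ j) d]
  have hz1 : z = 1 ↔ (d : ℤ) ∣ m := by
    rw [hz, Complex.exp_eq_one_iff]
    have hpi := Complex.two_pi_I_ne_zero
    constructor
    · rintro ⟨n, hn⟩
      refine ⟨n, ?_⟩
      have h : (2 * Real.pi * Complex.I) * (m : ℂ) = (2 * Real.pi * Complex.I) * (d * n) := by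
        field_simp at hn
        linear_combination (2 * Real.pi * Complex.I) * hn
      exact_mod_cast mul_left_cancel₀ hpi h
    · rintro ⟨n, rfl⟩
      exact ⟨n, by push_cast; field_simp⟩
  split_ifs with h
  · simp [hz1.2 h]
  · rw [geom_sum_eq (fun h1 => h (hz1.1 h1)), hpow]
    simp

/-- A family with `star`-orthonormal Gram matrix is linearly independent. -/
theorem linearIndependent_of_sum_star_mul_eq_ite {ι n : Type*} [Fintype ι] [DecidableEq ι]
    [Fintype n] (V : ι → n → ℂ)
    (h : ∀ k l, (∑ p, star (V k p) * V l p) = if k = l then 1 else 0) :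
    LinearIndependent ℂ V := by
  rw [Fintype.linearIndependent_iff]
  intro g hg k
  have h0 : ∑ p, star (V k p) * (∑ i, g i • V i) p = 0 := by rw [hg]; simp
  simp only [Finset.sum_apply, Pi.smul_apply, smul_eq_mul, Finset.mul_sum] at h0
  rw [Finset.sum_comm] at h0
  have h1 : ∀ i, ∑ p, star (V k p) * (g i * V i p) = g i * if k = i then 1 else 0 := by
    intro i
    rw [← h k i, Finset.mul_sum]
    exact Finset.sum_congr rfl fun p _ => by ring
  simp_rw [h1] at h0
  simpa using h0

/-- The interaction matrix acts as `μ` plus `w` times the sum over all other sites. -/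
theorem mulVec_interaction {n : Type*} [Fintype n] [DecidableEq n] (μ w : ℂ)
    (H : Matrix (n × Bool) (n × Bool) ℂ)
    (hH : ∀ p q, H p q = if p = q then μ else if p.1 = q.1 then 0 else w)
    (v : n × Bool → ℂ) (p : n × Bool) :
    H.mulVec v p
      = μ * v p + w * (∑ j, (v (j, true) + v (j, false)) - (v (p.1, true) + v (p.1, false))) := by
  have hsplit : ∀ q, H p q * v q
      = (if p = q then μ * v q else 0) + (w * v q - if p.1 = q.1 then w * v q else 0) := by
    intro q
    rw [hH]
    by_cases h : p = q
    · simp [h]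
    · by_cases h1 : p.1 = q.1 <;> simp [h, h1]
  simp only [Matrix.mulVec, dotProduct, hsplit, Finset.sum_add_distrib, Finset.sum_sub_distrib]
  simp only [Finset.sum_ite_eq, Finset.mem_univ, if_true, Fintype.sum_prod_type,
    Fintype.sum_bool, Finset.sum_add_distrib, ← Finset.mul_sum]
  ring


/-- Eigendecomposition of the tensor-decomposition interaction matrix (Lemma 7).
Coordinates of `ℂ^{2d}` are indexed by pairs `(j, σ)` with `j ∈ Fin d` and `σ : Bool`
(`true` standing for `+`). The symmetric Fourier vectors (indexed by `Sum.inl k`,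
`k` standing for `k+1 ∈ {1,…,d}`) are eigenvectors with eigenvalue `μ − 2w` for
`k = 1, …, d−1` and `μ + 2w(d−1)` for `k = d`, the antisymmetric vectors (indexed by
`Sum.inr k`) are eigenvectors with eigenvalue `μ`, and together they form an
orthonormal basis of `ℂ^{2d}`. -/
theorem tensor_decomposition_eigendecomposition
    (d : ℕ) (hd : 1 ≤ d) (μ w : ℝ)
    (H : Matrix (Fin d × Bool) (Fin d × Bool) ℂ)
    (hH : ∀ p q : Fin d × Bool,
      H p q = if p = q then (μ : ℂ) else if p.1 = q.1 then 0 else (w : ℂ))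
    (V : (Fin d ⊕ Fin d) → (Fin d × Bool → ℂ))
    (hVsym : ∀ (k : Fin d) (p : Fin d × Bool),
      V (Sum.inl k) p = (1 / Real.sqrt (2 * d) : ℝ) *
        Complex.exp (2 * Real.pi * Complex.I * ((k.1 : ℂ) + 1) * ((p.1.1 : ℂ) + 1) / d))
    (hVasym : ∀ (k : Fin d) (p : Fin d × Bool),
      V (Sum.inr k) p = (1 / Real.sqrt 2 : ℝ) *
        (if p.1 = k then (if p.2 then 1 else -1) else 0))
    (lam : (Fin d ⊕ Fin d) → ℝ)
    (hlamsym : ∀ k : Fin d,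
      lam (Sum.inl k) = if k.1 + 1 = d then μ + 2 * w * ((d : ℝ) - 1) else μ - 2 * w)
    (hlamasym : ∀ k : Fin d, lam (Sum.inr k) = μ) :
    (∀ k : Fin d ⊕ Fin d, H.mulVec (V k) = fun p => (lam k : ℂ) * V k p)
    ∧ (∀ k l : Fin d ⊕ Fin d, (∑ p, star (V k p) * V l p) = if k = l then 1 else 0)
    ∧ Submodule.span ℂ (Set.range V) = ⊤ := by
  have hd0 : (d : ℂ) ≠ 0 := by exact_mod_cast (by omega : d ≠ 0)
  have horth : ∀ k l : Fin d ⊕ Fin d, (∑ p, star (V k p) * V l p) = if k = l then 1 else 0 := by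
    have hsq2 : ((Real.sqrt 2 : ℝ) : ℂ) ^ 2 = 2 := by
      rw [← Complex.ofReal_pow, Real.sq_sqrt (by norm_num)]; norm_num
    have hsq2d : ((Real.sqrt (2 * d) : ℝ) : ℂ) ^ 2 = 2 * d := by
      rw [← Complex.ofReal_pow, Real.sq_sqrt (by positivity)]; norm_num
    have hs2 : ((Real.sqrt 2 : ℝ) : ℂ) ≠ 0 := fun h => by simp [h] at hsq2
    rintro (k | k) (l | l)
    · have hterm : ∀ p : Fin d × Bool, star (V (Sum.inl k) p) * V (Sum.inl l) p
          = (1 / (2 * d : ℂ)) * Complex.exp (2 * Real.pi * Complex.I *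
              (((l.1 : ℤ) - (k.1 : ℤ) : ℤ) : ℂ) * ((p.1.1 : ℂ) + 1) / d) := by
        intro p
        rw [hVsym, hVsym, ← hsq2d]
        have hexp : Complex.exp (2 * Real.pi * Complex.I *
              (((l.1 : ℤ) - (k.1 : ℤ) : ℤ) : ℂ) * ((p.1.1 : ℂ) + 1) / d)
            = star (Complex.exp (2 * Real.pi * Complex.I * ((k.1 : ℂ) + 1) *
                ((p.1.1 : ℂ) + 1) / d)) *
              Complex.exp (2 * Real.pi * Complex.I * ((l.1 : ℂ) + 1) *
                ((p.1.1 : ℂ) + 1) / d) := by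
          rw [Complex.star_def, ← Complex.exp_conj, ← Complex.exp_add]
          congr 1
          simp only [map_mul, map_div₀, map_add, map_one, map_natCast, map_ofNat,
            Complex.conj_ofReal, Complex.conj_I]
          push_cast
          ring
        rw [hexp, star_mul', Complex.star_def, Complex.conj_ofReal]
        push_cast
        ring
      simp only [hterm]
      rw [← Finset.mul_sum, Fintype.sum_prod_type]
      simp only [Fintype.sum_bool, Finset.sum_add_distrib]
      rw [sum_exp_two_pi_mul_int_div d hd]
      have hdvd : (d : ℤ) ∣ (l.1 : ℤ) - (k.1 : ℤ) ↔ k = l := by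
        constructor
        · intro h
          have h0 := Int.eq_zero_of_abs_lt_dvd h (by rw [abs_lt]; omega)
          exact Fin.ext (by omega)
        · rintro rfl
          simp
      simp only [hdvd, Sum.inl.injEq]
      split_ifs
      · field_simp
        ring
      · simp
    · simp [Fintype.sum_prod_type, hVsym, hVasym]
    · rw [Fintype.sum_prod_type]
      simp only [reduceCtorEq, if_false]
      refine Finset.sum_eq_zero fun x _ => ?_
      by_cases hx : x = k <;> simp [hVsym, hVasym, hx]
    · by_cases h : k = l
      · subst h
        simp [Fintype.sum_prod_type, hVasym]
        field_simp
        rw [hsq2]; norm_num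
      · simp [Fintype.sum_prod_type, hVasym, h, Ne.symm h]
  refine ⟨?_, horth, ?_⟩
  · rintro (k | k) <;> funext p <;> rw [mulVec_interaction (μ : ℂ) (w : ℂ) H hH]
    · have hbool : ∀ j b, V (Sum.inl k) (j, b) = V (Sum.inl k) (j, true) := fun j b => by
        rw [hVsym, hVsym]
      have hp : V (Sum.inl k) p = V (Sum.inl k) (p.1, true) := hbool p.1 p.2
      have hsum : ∑ j, V (Sum.inl k) (j, true) =
          if k.1 + 1 = d then d * V (Sum.inl k) (p.1, true) else 0 := by
        have hS := sum_exp_two_pi_mul_int_div d hd ((k.1 : ℤ) + 1)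
        have hdvd : (d : ℤ) ∣ (k.1 : ℤ) + 1 ↔ k.1 + 1 = d := by
          constructor
          · intro h
            have := Int.le_of_dvd (by omega) h
            omega
          · intro h
            exact ⟨1, by omega⟩
        simp only [hdvd] at hS
        push_cast at hS
        simp only [hVsym, ← Finset.mul_sum, hS]
        split_ifs with h
        · have hk : (k.1 : ℂ) + 1 = d := by exact_mod_cast h
          have h1 : Complex.exp (2 * Real.pi * Complex.I * d * ((p.1.1 : ℂ) + 1) / d) = 1 :=
            Complex.exp_eq_one_iff.2 ⟨p.1.1 + 1, by push_cast; field_simp⟩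
          rw [hk, h1]
          ring
        · simp
      simp only [hbool _ false, Finset.sum_add_distrib, hsum, hp, hlamsym]
      split_ifs <;> push_cast <;> ring
    · have hanti : ∀ j, V (Sum.inr k) (j, true) + V (Sum.inr k) (j, false) = 0 := fun j => by
        rw [hVasym, hVasym]
        by_cases h : j = k <;> simp [h]
      simp [hanti, hlamasym]
  · refine (linearIndependent_of_sum_star_mul_eq_ite V horth).span_eq_top_of_card_eq_finrank' ?_
    simp
    ring
end

section
/- Assume d ≥ 2 and w ≠ 0, so that the three eigenvalues μ − 2w, μ + 2w(d−1), and μ of H are pairwise distinct. For basis indices α = (j(α), π_α) and β = (j(β), π_β), define p(∞, β | α) := Σ_{(k,k') : λ_k = λ_{k'}} ⟨e_β, E_k⟩⟨E_k, e_α⟩⟨e_α, E_{k'}⟩⟨E_{k'}, e_β⟩, where (E_k)_{k=1}^{2d} is the orthonormal eigenbasis of H with eigenvalues (λ_k) given by: E_k = (1/√(2d)) Σ_j e^{2πi·kj/d}(e_{(j,+)} + e_{(j,−)}) with λ_k = μ − 2w for k = 1, …, d−1, λ_d = μ + 2w(d−1), and E_k = (1/√2)(e_{(k−d,+)} − e_{(k−d,−)})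 with λ_k = μ for k = d+1, …, 2d, and the sum runs over all ordered pairs (k,k') with λ_k = λ_{k'}. Then p(∞, β | α) = 1/(2d²) if j(α) ≠ j(β), and p(∞, β | α) = 1/2 − (d−1)/(2d²) if j(α) = j(β). (Lemma 9.) -/
/-- Orthogonality of the characters of `ℤ/d`, summed over the exponents `1, …, d`. -/
theorem sum_exp_two_pi_I_mul_sub (d : ℕ) (a b : Fin d) :
    ∑ k : Fin d, Complex.exp
        (2 * Real.pi * Complex.I * ((k.1 : ℂ) + 1) * ((b.1 : ℂ) - a.1) / d)
      = if a = b then (d : ℂ) else 0 := by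
  split_ifs with hab
  · simp [hab]
  have hd : (d : ℂ) ≠ 0 := by
    exact_mod_cast (Nat.zero_lt_of_lt a.2).ne'
  set z := Complex.exp (2 * Real.pi * Complex.I * ((b.1 : ℂ) - a.1) / d) with hz
  have hpow (k : Fin d) : Complex.exp
      (2 * Real.pi * Complex.I * ((k.1 : ℂ) + 1) * ((b.1 : ℂ) - a.1) / d) = z * z ^ k.1 := by
    rw [← pow_succ', hz, ← Complex.exp_nat_mul]
    congr 1
    push_cast
    ring
  have hzd : z ^ d = 1 := by
    rw [hz, ← Complex.exp_nat_mul, Complex.exp_eq_one_iff]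
    refine ⟨(b.1 : ℤ) - a.1, ?_⟩
    push_cast
    field_simp
  have hz1 : z ≠ 1 := by
    rw [hz, Ne, Complex.exp_eq_one_iff]
    rintro ⟨n, hn⟩
    have hba : ((b.1 : ℂ) - a.1) = n * d := by
      apply mul_left_cancel₀ Complex.two_pi_I_ne_zero
      field_simp at hn
      linear_combination (2 * Real.pi * Complex.I) * hn
    have hdvd : (d : ℤ) ∣ (b.1 : ℤ) - a.1 := ⟨n, by
      rw [mul_comm]
      exact_mod_cast hba⟩
    have hlt : |(b.1 : ℤ) - a.1| < d := by
      rw [abs_lt]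
      omega
    have := Int.eq_zero_of_abs_lt_dvd hdvd hlt
    exact hab (Fin.ext (by omega))
  simp_rw [hpow]
  rw [← Finset.mul_sum, Fin.sum_univ_eq_sum_range (fun k => z ^ k), geom_sum_eq hz1, hzd]
  simp

/-- A double sum over pairs of indices with equal labels, when the labels on `inl` take one value
except at the last index, and are constant on `inr`. -/
theorem sum_sum_ite_label_eq {n m : ℕ} (lam : Fin (n + 1) ⊕ Fin m → ℝ) {x y z : ℝ}
    (hxy : x ≠ y) (hxz : x ≠ z) (hyz : y ≠ z)
    (hx : ∀ k : Fin n, lam (Sum.inl k.castSucc) = x) (hy : lam (Sum.inl (Fin.last n)) = y)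
    (hz : ∀ k, lam (Sum.inr k) = z) (f g : Fin (n + 1) ⊕ Fin m → ℂ) :
    (∑ k, ∑ k', if lam k = lam k' then f k * g k' else 0)
      = (∑ k : Fin n, f (Sum.inl k.castSucc)) * (∑ k : Fin n, g (Sum.inl k.castSucc))
        + f (Sum.inl (Fin.last n)) * g (Sum.inl (Fin.last n))
        + (∑ k, f (Sum.inr k)) * (∑ k, g (Sum.inr k)) := by
  simp [Fintype.sum_sum_type, Fin.sum_univ_castSucc, hx, hy, hz, hxy, hxz, hyz, hxy.symm,
    hxz.symm, hyz.symm, Finset.sum_mul_sum]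

/-- Limiting transition probabilities for the tensor-decomposition interaction matrix
(Lemma 9): with the orthonormal eigenbasis `(E_k)` of `H` (symmetric Fourier vectors with
eigenvalues `μ − 2w` for `k = 1,…,d−1`, `μ + 2w(d−1)` for `k = d`, and antisymmetric
vectors with eigenvalue `μ`), the quantity
`p(∞, β | α) = Σ_{λ_k = λ_{k'}} ⟨e_β,E_k⟩⟨E_k,e_α⟩⟨e_α,E_{k'}⟩⟨E_{k'},e_β⟩`
equals `1/(2d²)` if `j(α) ≠ j(β)` and `1/2 − (d−1)/(2d²)` if `j(α) = j(β)`. -/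
theorem tensor_decomposition_limit_probability
    (d : ℕ) (hd : 2 ≤ d) (μ w : ℝ) (hw : w ≠ 0)
    (H : Matrix (Fin d × Bool) (Fin d × Bool) ℂ)
    (hH : ∀ p q : Fin d × Bool,
      H p q = if p = q then (μ : ℂ) else if p.1 = q.1 then 0 else (w : ℂ))
    (V : (Fin d ⊕ Fin d) → (Fin d × Bool → ℂ))
    (hVsym : ∀ (k : Fin d) (p : Fin d × Bool),
      V (Sum.inl k) p = (1 / Real.sqrt (2 * d) : ℝ) *
        Complex.exp (2 * Real.pi * Complex.I * ((k.1 : ℂ) + 1) * ((p.1.1 : ℂ) + 1) / d))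
    (hVasym : ∀ (k : Fin d) (p : Fin d × Bool),
      V (Sum.inr k) p = (1 / Real.sqrt 2 : ℝ) *
        (if p.1 = k then (if p.2 then 1 else -1) else 0))
    (lam : (Fin d ⊕ Fin d) → ℝ)
    (hlamsym : ∀ k : Fin d,
      lam (Sum.inl k) = if k.1 + 1 = d then μ + 2 * w * ((d : ℝ) - 1) else μ - 2 * w)
    (hlamasym : ∀ k : Fin d, lam (Sum.inr k) = μ)
    (α β : Fin d × Bool) :
    (∑ k : Fin d ⊕ Fin d, ∑ k' : Fin d ⊕ Fin d,
        if lam k = lam k' then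
          V k β * star (V k α) * V k' α * star (V k' β)
        else 0)
      = if α.1 = β.1 then (1 / 2 - ((d : ℂ) - 1) / (2 * (d : ℂ) ^ 2))
        else 1 / (2 * (d : ℂ) ^ 2) := by
  have hsym (k : Fin d) : V (Sum.inl k) β * star (V (Sum.inl k) α) = 1 / (2 * d) *
      Complex.exp (2 * Real.pi * Complex.I * ((k.1 : ℂ) + 1) * ((β.1.1 : ℂ) - α.1.1) / d) := by
    have hsqrt : (((1 / Real.sqrt (2 * d) : ℝ) : ℂ)) * ((1 / Real.sqrt (2 * d) : ℝ) : ℂ)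
        = 1 / (2 * d) := by
      rw [← Complex.ofReal_mul, div_mul_div_comm, Real.mul_self_sqrt (by positivity)]
      push_cast
      ring
    rw [hVsym, hVsym, star_mul', Complex.star_def, Complex.conj_ofReal,
      ← Complex.exp_conj, mul_mul_mul_comm, hsqrt, ← Complex.exp_add]
    congr 2
    simp only [map_div₀, map_mul, map_add, map_one, map_natCast, Complex.conj_ofReal,
      Complex.conj_I, map_ofNat]
    ring
  have hsum : ∑ k : Fin d, V (Sum.inl k) β * star (V (Sum.inl k) α)
      = if α.1 = β.1 then 1 / 2 else 0 := by
    simp_rw [hsym]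
    rw [← Finset.mul_sum, sum_exp_two_pi_I_mul_sub]
    have hd0 : (d : ℂ) ≠ 0 := by
      norm_cast
      omega
    split_ifs
    · field_simp
    · simp
  have hasum : ∑ k : Fin d, V (Sum.inr k) β * star (V (Sum.inr k) α)
      = if α.1 = β.1 then (if α.2 = β.2 then 1 / 2 else -1 / 2) else 0 := by
    have hsqrt : (((1 / Real.sqrt 2 : ℝ) : ℂ)) * ((1 / Real.sqrt 2 : ℝ) : ℂ) = 1 / 2 := by
      rw [← Complex.ofReal_mul, div_mul_div_comm, Real.mul_self_sqrt (by positivity)]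
      push_cast
      ring
    have hterm (k : Fin d) : V (Sum.inr k) β * star (V (Sum.inr k) α) = 1 / 2 *
        ((if β.1 = k then (if β.2 then 1 else -1) else 0) *
          star (if α.1 = k then (if α.2 then 1 else -1) else 0 : ℂ)) := by
      rw [hVasym, hVasym, star_mul', Complex.star_def, Complex.conj_ofReal, mul_mul_mul_comm,
        hsqrt]
    simp_rw [hterm]
    rw [← Finset.mul_sum, Finset.sum_eq_single β.1 (by
      intro b _ hb
      simp [hb.symm]) (by simp)]
    by_cases hab : α.1 = β.1
    · cases hα : α.2 <;> cases hβ : β.2 <;> simp [hab] <;> ring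
    · simp [hab]
  obtain ⟨n, rfl⟩ : ∃ n, d = n + 1 := ⟨d - 1, by omega⟩
  have hlast : V (Sum.inl (Fin.last n)) β * star (V (Sum.inl (Fin.last n)) α)
      = 1 / (2 * ((n + 1 : ℕ) : ℂ)) := by
    rw [hsym, Complex.exp_eq_one_iff.2 ⟨(β.1.1 : ℤ) - α.1.1, ?_⟩, mul_one]
    have : (n : ℂ) + 1 ≠ 0 := by exact_mod_cast n.succ_ne_zero
    push_cast [Fin.val_last]
    field_simp
  have hn : (n : ℝ) ≠ 0 := by
    norm_cast
    omega
  have hn1 : (n : ℝ) + 1 ≠ 0 := by positivity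
  have hgroup := sum_sum_ite_label_eq lam (x := μ - 2 * w) (y := μ + 2 * w * n) (z := μ)
    (fun h => mul_ne_zero hw hn1 (by linarith)) (fun h => hw (by linarith))
    (fun h => mul_ne_zero hw hn (by linarith))
    (fun k => by rw [hlamsym, if_neg (by simpa using k.2.ne)])
    (by simp [hlamsym]) hlamasym
    (fun k => V k β * star (V k α)) (fun k => star (V k β * star (V k α)))
  have hterm (k k' : Fin (n + 1) ⊕ Fin (n + 1)) :
      V k β * star (V k α) * V k' α * star (V k' β)
        = V k β * star (V k α) * star (V k' β * star (V k' α)) := by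
    rw [star_mul', star_star]
    ring
  simp_rw [hterm]
  rw [hgroup]
  simp_rw [← star_sum]
  rw [Fin.sum_univ_castSucc, hlast] at hsum
  rw [eq_sub_of_add_eq hsum, hlast, hasum]
  have hc : (n : ℂ) + 1 ≠ 0 := by exact_mod_cast n.succ_ne_zero
  split_ifs <;> simp <;> field_simp <;> ring
end

section
/- For every d ≥ 1 and every ε with 0 < ε < 1, there exists a finite set A of unit vectors in ℝ^d such that ‖x − y‖ ≥ ε for all distinct x, y ∈ A, and the cardinality of A satisfies |A| ≥ (1/(2ε) + 1/2)^d − (1/(2ε) − 1/2)^d. (Sphere packing lemma used in the proof of Proposition 6.) -/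
open MeasureTheory Metric in
/-- If every unit vector is within `ε` of the finite set `A`, then comparing volumes of the annulus
of radii `1 - ε`, `1 + ε` and of balls of radius `2 * ε` bounds the cardinality of `A` from below. -/
lemma annulus_volume_le_card {d : ℕ} {ε : ℝ} (hε0 : 0 < ε) (hε1 : ε < 1)
    (A : Finset (EuclideanSpace ℝ (Fin d)))
    (hA : ∀ u : EuclideanSpace ℝ (Fin d), ‖u‖ = 1 → ∃ a ∈ A, ‖u - a‖ < ε) :
    (1 + ε) ^ d - (1 - ε) ^ d ≤ (A.card : ℝ) * (2 * ε) ^ d := by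
  set V := (volume : Measure (EuclideanSpace ℝ (Fin d))).real (ball 0 1) with hV
  have hVpos : 0 < V :=
    ENNReal.toReal_pos (measure_ball_pos _ _ one_pos).ne' measure_ball_lt_top.ne
  have hball (x : EuclideanSpace ℝ (Fin d)) {r : ℝ} (hr : 0 < r) :
      (volume : Measure (EuclideanSpace ℝ (Fin d))).real (ball x r) = r ^ d * V := by
    rw [measureReal_def, Measure.addHaar_ball_of_pos _ _ hr, finrank_euclideanSpace_fin,
      ENNReal.toReal_mul, ENNReal.toReal_ofReal (by positivity), hV, measureReal_def]
  have hcover : ball (0 : EuclideanSpace ℝ (Fin d)) (1 + ε) ⊆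
      ball 0 (1 - ε) ∪ ⋃ a ∈ A, ball a (2 * ε) := by
    intro x hx
    rw [mem_ball_zero_iff] at hx
    by_cases hx' : ‖x‖ < 1 - ε
    · exact Or.inl (mem_ball_zero_iff.2 hx')
    have hx0 : 0 < ‖x‖ := by linarith
    obtain ⟨a, ha, hua⟩ := hA (‖x‖⁻¹ • x) (by simp [norm_smul, hx0.ne'])
    have hxu : ‖x - ‖x‖⁻¹ • x‖ ≤ ε := by
      have h : x - ‖x‖⁻¹ • x = (1 - ‖x‖⁻¹) • x := by rw [sub_smul, one_smul]
      rw [h, norm_smul, Real.norm_eq_abs, ← abs_of_pos hx0, ← abs_mul, abs_of_pos hx0, sub_mul,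
        inv_mul_cancel₀ hx0.ne', abs_le]
      constructor <;> linarith
    refine Or.inr (Set.mem_iUnion₂.2 ⟨a, ha, ?_⟩)
    rw [mem_ball, dist_eq_norm]
    linarith [norm_sub_le_norm_sub_add_norm_sub x (‖x‖⁻¹ • x) a]
  have hfin : volume (ball (0 : EuclideanSpace ℝ (Fin d)) (1 - ε) ∪ ⋃ a ∈ A, ball a (2 * ε)) ≠ ⊤ :=
    ((isBounded_ball.union
      ((Bornology.isBounded_biUnion_finset A).2 fun _ _ ↦ isBounded_ball)).measure_lt_top).ne
  have hvol := (measureReal_mono hcover hfin).trans <| (measureReal_union_le _ _).trans <|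
    add_le_add_right (measureReal_biUnion_finset_le A fun a ↦ ball a (2 * ε)) _
  simp only [hball _ (show 0 < 1 + ε by linarith), hball _ (show 0 < 1 - ε by linarith),
    hball _ (show 0 < 2 * ε by linarith), Finset.sum_const, nsmul_eq_mul] at hvol
  refine le_of_mul_le_mul_right ?_ hVpos
  linarith

/-- Sphere packing lemma used in the proof of Proposition 6: for every `d ≥ 1` and
`0 < ε < 1` there is a finite set `A` of unit vectors in `ℝ^d` that is `ε`-separated and
has cardinality at least `(1/(2ε) + 1/2)^d − (1/(2ε) − 1/2)^d`. -/
theorem separated_unit_vectors_packing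
    (d : ℕ) (hd : 1 ≤ d) (ε : ℝ) (hε0 : 0 < ε) (hε1 : ε < 1) :
    ∃ A : Finset (EuclideanSpace ℝ (Fin d)),
      (∀ x ∈ A, ‖x‖ = 1) ∧
      (∀ x ∈ A, ∀ y ∈ A, x ≠ y → ε ≤ ‖x - y‖) ∧
      (1 / (2 * ε) + 1 / 2) ^ d - (1 / (2 * ε) - 1 / 2) ^ d ≤ (A.card : ℝ) := by
  classical
  by_contra! hsmall
  let S : Set ℕ := {n | ∃ A : Finset (EuclideanSpace ℝ (Fin d)), (∀ x ∈ A, ‖x‖ = 1) ∧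
    (∀ x ∈ A, ∀ y ∈ A, x ≠ y → ε ≤ ‖x - y‖) ∧ A.card = n}
  have hS : BddAbove S := by
    refine ⟨⌈(1 / (2 * ε) + 1 / 2) ^ d - (1 / (2 * ε) - 1 / 2) ^ d⌉₊, ?_⟩
    rintro n ⟨A, hunit, hsep, rfl⟩
    exact_mod_cast (hsmall A hunit hsep).le.trans (Nat.le_ceil _)
  obtain ⟨A, hunit, hsep, hcard⟩ := Nat.sSup_mem (s := S) ⟨0, ∅, by simp⟩ hS
  have hnet (u : EuclideanSpace ℝ (Fin d)) (hu : ‖u‖ = 1) : ∃ a ∈ A, ‖u - a‖ < ε := by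
    by_contra! hfar
    have huA : u ∉ A := fun h ↦ by simpa [hε0.not_ge] using hfar u h
    have hmem : A.card + 1 ∈ S := by
      refine ⟨insert u A, ?_, ?_, Finset.card_insert_of_notMem huA⟩
      · simpa [hu] using hunit
      · intro x hx y hy hxy
        rcases Finset.mem_insert.1 hx with rfl | hxA <;>
          rcases Finset.mem_insert.1 hy with rfl | hyA
        · exact absurd rfl hxy
        · exact hfar y hyA
        · exact norm_sub_rev x y ▸ hfar x hxA
        · exact hsep x hxA y hyA hxy
    have := le_csSup hS hmem
    omega
  refine (hsmall A hunit hsep).not_ge ?_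
  have hadd : 1 / (2 * ε) + 1 / 2 = (1 + ε) / (2 * ε) := by field_simp
  have hsub : 1 / (2 * ε) - 1 / 2 = (1 - ε) / (2 * ε) := by field_simp
  rw [hadd, hsub, div_pow, div_pow, ← sub_div, div_le_iff₀ (by positivity)]
  exact annulus_volume_le_card hε0 hε1 A hnet
end

section
/- The infimum, over all piecewise C¹ paths γ : [0,1] → S^{d−1} with γ(0) = a₁ and γ(1) = a₂, of the Agmon length ∫_0^1 √(f(γ(t))) · ‖γ'(t)‖ dt equals √2/2; and the infimum over all piecewise C¹ paths on S^{d−1} from a₁ to −a₁ equals √2. (Agmon distances between minima of the tensor-decomposition landscape, Lemma on Agmon distance in Appendix C.) -/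
open MeasureTheory Set

/-- A map `γ : ℝ → E` is piecewise `C¹` on `[0,1]` if it is continuous on `[0,1]` and
there is a finite monotone partition `0 = t_0 ≤ t_1 ≤ … ≤ t_n = 1` such that `γ` is
`C¹` on each subinterval `[t_i, t_{i+1}]`. -/
def PiecewiseC1 {E : Type*} [NormedAddCommGroup E] [NormedSpace ℝ E] (γ : ℝ → E) : Prop :=
  ContinuousOn γ (Set.Icc 0 1) ∧
    ∃ (n : ℕ) (t : Fin (n + 1) → ℝ), t 0 = 0 ∧ t (Fin.last n) = 1 ∧ Monotone t ∧
      ∀ i : Fin n, ContDiffOn ℝ 1 γ (Set.Icc (t i.castSucc) (t i.succ))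

theorem hasDerivAt_mul_abs_self (x : ℝ) : HasDerivAt (fun y : ℝ => y * |y|) (2 * |x|) x := by
  rcases lt_trichotomy x 0 with hx | rfl | hx
  · have h := ((hasDerivAt_id x).mul (hasDerivAt_abs_neg hx))
    exact h.congr_deriv (by rw [abs_of_neg hx, id]; ring)
  · rw [hasDerivAt_iff_isLittleO_nhds_zero]
    have h : (fun h : ℝ => |h|) =o[nhds 0] (fun _ : ℝ => (1 : ℝ)) := by
      rw [Asymptotics.isLittleO_one_iff]
      simpa using (continuous_abs (G := ℝ)).tendsto 0
    simpa using (Asymptotics.isBigO_refl (fun h : ℝ => h) (nhds 0)).mul_isLittleO h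
  · have h := ((hasDerivAt_id x).mul (hasDerivAt_abs_pos hx))
    exact h.congr_deriv (by rw [abs_of_pos hx, id]; ring)

section Sphere

variable {d : ℕ} {x v : EuclideanSpace ℝ (Fin d)}

theorem sum_sq_eq_one_of_norm_eq_one (hx : ‖x‖ = 1) : ∑ i, x i ^ 2 = 1 := by
  simpa [hx] using (EuclideanSpace.real_norm_sq_eq x).symm

/-- On the sphere, `1 - ∑ xᵢ⁴` dominates its value on the great circle with the same coordinate
`xⱼ` through a minimum. -/
theorem two_mul_sq_mul_le_one_sub_sum_pow_four (hx : ‖x‖ = 1) (j : Fin d) :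
    2 * x j ^ 2 * (1 - x j ^ 2) ≤ 1 - ∑ i, x i ^ 4 := by
  have h1 := sum_sq_eq_one_of_norm_eq_one hx
  rw [← Finset.add_sum_erase _ _ (Finset.mem_univ j)] at h1 ⊢
  have h2 : ∑ i ∈ Finset.univ.erase j, x i ^ 4 ≤ (∑ i ∈ Finset.univ.erase j, x i ^ 2) ^ 2 := by
    have := Finset.sum_sq_le_sq_sum_of_nonneg (s := Finset.univ.erase j) (f := fun i => x i ^ 2)
      (fun i _ => sq_nonneg _)
    simpa [← pow_mul] using this
  rw [eq_sub_of_add_eq' h1] at h2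
  nlinarith

/-- Cauchy–Schwarz against the component of the basis vector orthogonal to `x`. -/
theorem abs_apply_le_of_inner_eq_zero (hx : ‖x‖ = 1) (hxv : inner ℝ x v = 0) (j : Fin d) :
    |v j| ≤ √(1 - x j ^ 2) * ‖v‖ := by
  set e : EuclideanSpace ℝ (Fin d) := EuclideanSpace.single j 1
  have he : ∀ w, inner ℝ e w = w j := fun w => by simp [e, EuclideanSpace.inner_single_left]
  have h1 : inner ℝ (e - x j • x) v = v j := by
    rw [inner_sub_left, inner_smul_left, hxv, he]; simp
  have h2 : ‖e - x j • x‖ = √(1 - x j ^ 2) := by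
    rw [← Real.sqrt_sq (norm_nonneg _), norm_sub_sq_real, inner_smul_right, he, norm_smul, hx,
      mul_one, Real.norm_eq_abs, sq_abs, show ‖e‖ = 1 by simp [e]]
    ring_nf
  rw [← h1, ← h2]
  exact abs_real_inner_le_norm _ _

/-- `x ↦ -(√2 / 2) * xⱼ * |xⱼ|` is a calibration for the Agmon metric on the sphere. -/
theorem neg_sqrt_two_mul_abs_mul_le (hx : ‖x‖ = 1) (hxv : inner ℝ x v = 0) (j : Fin d) :
    -(√2 / 2 * (2 * |x j| * v j)) ≤ √(1 - ∑ i, x i ^ 4) * ‖v‖ := by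
  have h : √(2 * x j ^ 2 * (1 - x j ^ 2)) = √2 * |x j| * √(1 - x j ^ 2) := by
    rw [Real.sqrt_mul (by positivity), Real.sqrt_mul zero_le_two, Real.sqrt_sq_eq_abs]
  calc -(√2 / 2 * (2 * |x j| * v j)) = √2 * |x j| * -v j := by ring
    _ ≤ √2 * |x j| * (√(1 - x j ^ 2) * ‖v‖) := by
      gcongr
      exact (neg_le_abs _).trans (abs_apply_le_of_inner_eq_zero hx hxv j)
    _ = √(2 * x j ^ 2 * (1 - x j ^ 2)) * ‖v‖ := by rw [h, mul_assoc _ _ ‖v‖]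
    _ ≤ _ := by
      gcongr
      exact two_mul_sq_mul_le_one_sub_sum_pow_four hx j

end Sphere

theorem inner_eq_zero_of_hasDerivAt_of_norm_eq_one {E : Type*} [NormedAddCommGroup E]
    [InnerProductSpace ℝ E] {γ : ℝ → E} {γ' : E} {t : ℝ} (hγ : HasDerivAt γ γ' t)
    (h1 : ∀ᶠ s in nhds t, ‖γ s‖ = 1) : inner ℝ (γ t) γ' = 0 := by
  have h2 : (fun s => ‖γ s‖ ^ 2) =ᶠ[nhds t] fun _ => (1 : ℝ) := by
    filter_upwards [h1] with s hs
    rw [hs, one_pow]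
  have := hγ.norm_sq.unique ((hasDerivAt_const t (1 : ℝ)).congr_of_eventuallyEq h2)
  linarith

section Path

variable {d : ℕ} {γ : ℝ → EuclideanSpace ℝ (Fin d)} {a b : ℝ}

theorem integrableOn_agmon_of_contDiffOn (hab : a ≤ b) (hγ : ContDiffOn ℝ 1 γ (Icc a b)) :
    IntegrableOn (fun t => √(1 - ∑ i, γ t i ^ 4) * ‖deriv γ t‖) (Icc a b) := by
  rw [integrableOn_Icc_iff_integrableOn_Ioo]
  obtain rfl | hab := hab.eq_or_lt
  · simp
  have hc : ContinuousOn (fun t => √(1 - ∑ i, γ t i ^ 4) * ‖derivWithin γ (Icc a b) t‖)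
      (Icc a b) := by
    have h1 := hγ.continuousOn
    have h2 := hγ.continuousOn_derivWithin (uniqueDiffOn_Icc hab) le_rfl
    fun_prop
  refine ((hc.integrableOn_Icc).mono_set Ioo_subset_Icc_self).congr_fun (fun t ht => ?_)
    measurableSet_Ioo
  simp only [derivWithin_of_mem_nhds (Icc_mem_nhds ht.1 ht.2)]

theorem sqrt_two_mul_le_integral_of_contDiffOn (hab : a ≤ b) (hγ : ContDiffOn ℝ 1 γ (Icc a b))
    (h1 : ∀ t ∈ Icc a b, ‖γ t‖ = 1) (j : Fin d) :
    √2 / 2 * (γ a j * |γ a j| - γ b j * |γ b j|) ≤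
      ∫ t in a..b, √(1 - ∑ i, γ t i ^ 4) * ‖deriv γ t‖ := by
  have h2 := hγ.continuousOn
  have h3 : ∀ t ∈ Ioo a b, HasDerivAt γ (deriv γ t) t := fun t ht =>
    ((hγ.differentiableOn one_ne_zero).differentiableAt (Icc_mem_nhds ht.1 ht.2)).hasDerivAt
  have h4 := intervalIntegral.sub_le_integral_of_hasDeriv_right_of_le
    (g := fun t => -(√2 / 2 * (γ t j * |γ t j|)))
    (g' := fun t => -(√2 / 2 * (2 * |γ t j| * deriv γ t j))) hab (by fun_prop)
    (fun t ht => by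
      have h5 : HasDerivAt (fun s => γ s j) (deriv γ t j) t :=
        (EuclideanSpace.proj (𝕜 := ℝ) j).hasFDerivAt.comp_hasDerivAt t (h3 t ht)
      exact (((hasDerivAt_mul_abs_self _).comp t h5).const_mul _).neg.hasDerivWithinAt)
    (integrableOn_agmon_of_contDiffOn hab hγ)
    (fun t ht => neg_sqrt_two_mul_abs_mul_le (h1 t (Ioo_subset_Icc_self ht))
      (inner_eq_zero_of_hasDerivAt_of_norm_eq_one (h3 t ht)
        (Filter.mem_of_superset (Icc_mem_nhds ht.1 ht.2) h1)) j)
  linarith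

theorem PiecewiseC1.sqrt_two_mul_le_integral (hγ : PiecewiseC1 γ)
    (h1 : ∀ t ∈ Icc (0 : ℝ) 1, ‖γ t‖ = 1) (j : Fin d) :
    √2 / 2 * (γ 0 j * |γ 0 j| - γ 1 j * |γ 1 j|) ≤
      ∫ t in (0 : ℝ)..1, √(1 - ∑ i, γ t i ^ 4) * ‖deriv γ t‖ := by
  obtain ⟨-, n, t, ht0, ht1, htm, hγ⟩ := hγ
  set g : ℝ → ℝ := fun t => √(1 - ∑ i, γ t i ^ 4) * ‖deriv γ t‖
  have key : ∀ i, IntervalIntegrable g volume 0 (t i) ∧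
      √2 / 2 * (γ 0 j * |γ 0 j| - γ (t i) j * |γ (t i) j|) ≤ ∫ s in (0 : ℝ)..t i, g s := by
    intro i
    induction i using Fin.induction with
    | zero => simp [ht0]
    | succ i ih =>
      have hle := htm i.castSucc_le_succ
      have hgi : IntervalIntegrable g volume (t i.castSucc) (t i.succ) := by
        rw [intervalIntegrable_iff_integrableOn_Icc_of_le hle]
        exact integrableOn_agmon_of_contDiffOn hle (hγ i)
      refine ⟨ih.1.trans hgi, ?_⟩
      rw [← intervalIntegral.integral_add_adjacent_intervals ih.1 hgi]
      have := sqrt_two_mul_le_integral_of_contDiffOn hle (hγ i) (fun s hs => h1 s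
        ⟨(ht0.symm.le.trans (htm (Fin.zero_le _))).trans hs.1,
          hs.2.trans ((htm (Fin.le_last _)).trans ht1.le)⟩) j
      linarith [ih.2]
  simpa [ht1] using (key (Fin.last n)).2

end Path

/-- The arc of the great circle through the distinct basis vectors `e_j` and `e_k` that starts at
`e_j` and has angular speed `ω`. -/
noncomputable def greatCircle {d : ℕ} (j k : Fin d) (ω t : ℝ) : EuclideanSpace ℝ (Fin d) :=
  Real.cos (ω * t) • EuclideanSpace.single j 1 + Real.sin (ω * t) • EuclideanSpace.single k 1

section GreatCircle

variable {d : ℕ} {j k : Fin d}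

theorem norm_smul_single_add_smul_single (hjk : j ≠ k) (a b : ℝ) :
    ‖(a • EuclideanSpace.single j 1 + b • EuclideanSpace.single k 1 :
      EuclideanSpace ℝ (Fin d))‖ = √(a ^ 2 + b ^ 2) := by
  rw [← Real.sqrt_sq (norm_nonneg _), norm_add_sq_real, norm_smul, norm_smul]
  simp [inner_smul_left, inner_smul_right, EuclideanSpace.inner_single_left, hjk]

theorem norm_greatCircle (hjk : j ≠ k) (ω t : ℝ) : ‖greatCircle j k ω t‖ = 1 := by
  rw [greatCircle, norm_smul_single_add_smul_single hjk, Real.cos_sq_add_sin_sq, Real.sqrt_one]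

theorem sum_greatCircle_pow_four (hjk : j ≠ k) (ω t : ℝ) :
    ∑ i, greatCircle j k ω t i ^ 4 = Real.cos (ω * t) ^ 4 + Real.sin (ω * t) ^ 4 := by
  rw [Finset.sum_eq_add_of_mem j k (Finset.mem_univ _) (Finset.mem_univ _) hjk]
  · simp [greatCircle, hjk, hjk.symm]
  · rintro i - ⟨hij, hik⟩
    simp [greatCircle, hij, hik]

theorem contDiff_greatCircle (j k : Fin d) (ω : ℝ) : ContDiff ℝ 1 (greatCircle j k ω) := by
  unfold greatCircle
  fun_prop

theorem piecewiseC1_greatCircle (j k : Fin d) (ω : ℝ) : PiecewiseC1 (greatCircle j k ω) :=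
  ⟨(contDiff_greatCircle j k ω).continuous.continuousOn, 1, ![0, 1], rfl, rfl,
    by simp [Fin.monotone_iff_le_succ], fun _ => (contDiff_greatCircle j k ω).contDiffOn⟩

theorem norm_deriv_greatCircle (hjk : j ≠ k) {ω : ℝ} (hω : 0 ≤ ω) (t : ℝ) :
    ‖deriv (greatCircle j k ω) t‖ = ω := by
  have h : HasDerivAt (fun s => ω * s) ω t := by simpa using (hasDerivAt_id t).const_mul ω
  have h' : HasDerivAt (greatCircle j k ω) _ t :=
    (h.cos.smul_const (EuclideanSpace.single j 1)).add
      (h.sin.smul_const (EuclideanSpace.single k 1))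
  rw [h'.deriv, norm_smul_single_add_smul_single hjk]
  rw [show (-Real.sin (ω * t) * ω) ^ 2 + (Real.cos (ω * t) * ω) ^ 2 = ω ^ 2 by
    linear_combination ω ^ 2 * Real.sin_sq_add_cos_sq (ω * t), Real.sqrt_sq hω]

theorem integral_greatCircle (hjk : j ≠ k) {ω : ℝ} (hω : ω ∈ Icc 0 Real.pi) :
    ∫ t in (0 : ℝ)..1, √(1 - ∑ i, greatCircle j k ω t i ^ 4) * ‖deriv (greatCircle j k ω) t‖ =
      √2 / 2 * (1 - Real.cos ω * |Real.cos ω|) := by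
  have h1 : ∀ t ∈ uIcc (0 : ℝ) 1, HasDerivAt
      (fun s => -(√2 / 2 * (Real.cos (ω * s) * |Real.cos (ω * s)|)))
      (√(1 - ∑ i, greatCircle j k ω t i ^ 4) * ‖deriv (greatCircle j k ω) t‖) t := by
    intro t ht
    rw [uIcc_of_le zero_le_one] at ht
    have h : HasDerivAt (fun s => ω * s) ω t := by simpa using (hasDerivAt_id t).const_mul ω
    have hsin : 0 ≤ Real.sin (ω * t) := Real.sin_nonneg_of_nonneg_of_le_pi
      (mul_nonneg hω.1 ht.1) ((mul_le_of_le_one_right hω.1 ht.2).trans hω.2)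
    refine (((hasDerivAt_mul_abs_self _).comp t h.cos).const_mul (√2 / 2)).neg.congr_deriv ?_
    rw [norm_deriv_greatCircle hjk hω.1, sum_greatCircle_pow_four hjk,
      show 1 - (Real.cos (ω * t) ^ 4 + Real.sin (ω * t) ^ 4) =
        2 * (Real.cos (ω * t) * Real.sin (ω * t)) ^ 2 by
        linear_combination
          -(1 + Real.sin (ω * t) ^ 2 + Real.cos (ω * t) ^ 2) * Real.sin_sq_add_cos_sq (ω * t),
      Real.sqrt_mul zero_le_two, Real.sqrt_sq_eq_abs, abs_mul, abs_of_nonneg hsin]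
    ring
  rw [intervalIntegral.integral_eq_sub_of_hasDerivAt h1]
  · simp
    ring
  · refine Continuous.intervalIntegrable ?_ _ _
    have h2 := (contDiff_greatCircle j k ω).continuous
    simp only [norm_deriv_greatCircle hjk hω.1]
    fun_prop

end GreatCircle


/-- Agmon distances between minima of the tensor-decomposition landscape
`f(x) = 1 − Σ xᵢ⁴` on the unit sphere: the infimum of the Agmon length
`∫₀¹ √(f(γ(t)))·‖γ'(t)‖ dt` over piecewise `C¹` paths on `S^{d−1}` from `a₁` to `a₂`
equals `√2/2`, and from `a₁` to `−a₁` equals `√2`. -/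
theorem agmon_distance_tensor_decomposition
    (d : ℕ) (hd : 2 ≤ d)
    (f : EuclideanSpace ℝ (Fin d) → ℝ)
    (hf : ∀ x, f x = 1 - ∑ i, (x i) ^ 4) :
    IsLeast
      {L : ℝ | ∃ γ : ℝ → EuclideanSpace ℝ (Fin d), PiecewiseC1 γ ∧
        (∀ t ∈ Set.Icc (0:ℝ) 1, ‖γ t‖ = 1) ∧
        γ 0 = EuclideanSpace.single (⟨0, by omega⟩ : Fin d) 1 ∧
        γ 1 = EuclideanSpace.single (⟨1, by omega⟩ : Fin d) 1 ∧
        L = ∫ t in (0:ℝ)..1, Real.sqrt (f (γ t)) * ‖deriv γ t‖}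
      (Real.sqrt 2 / 2)
    ∧ IsLeast
        {L : ℝ | ∃ γ : ℝ → EuclideanSpace ℝ (Fin d), PiecewiseC1 γ ∧
          (∀ t ∈ Set.Icc (0:ℝ) 1, ‖γ t‖ = 1) ∧
          γ 0 = EuclideanSpace.single (⟨0, by omega⟩ : Fin d) 1 ∧
          γ 1 = -EuclideanSpace.single (⟨0, by omega⟩ : Fin d) 1 ∧
          L = ∫ t in (0:ℝ)..1, Real.sqrt (f (γ t)) * ‖deriv γ t‖}
        (Real.sqrt 2) := by
  have h01 : (⟨0, by omega⟩ : Fin d) ≠ ⟨1, by omega⟩ := by simp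
  obtain rfl : f = fun x => 1 - ∑ i, x i ^ 4 := funext hf
  refine ⟨⟨⟨greatCircle ⟨0, by omega⟩ ⟨1, by omega⟩ (Real.pi / 2),
    piecewiseC1_greatCircle _ _ _, fun t _ => norm_greatCircle h01 _ t, by simp [greatCircle],
    by simp [greatCircle], ?_⟩, ?_⟩, ⟨⟨greatCircle ⟨0, by omega⟩ ⟨1, by omega⟩ Real.pi,
    piecewiseC1_greatCircle _ _ _, fun t _ => norm_greatCircle h01 _ t, by simp [greatCircle],
    by simp [greatCircle], ?_⟩, ?_⟩⟩
  · rw [integral_greatCircle h01 ⟨by positivity, by linarith [Real.pi_pos]⟩]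
    simp
  · rintro L ⟨γ, hγ, h1, h2, h3, rfl⟩
    have h := hγ.sqrt_two_mul_le_integral h1 ⟨0, by omega⟩
    simpa [h2, h3] using h
  · rw [integral_greatCircle h01 ⟨by positivity, le_rfl⟩]
    simp
    ring
  · rintro L ⟨γ, hγ, h1, h2, h3, rfl⟩
    have h := hγ.sqrt_two_mul_le_integral h1 ⟨0, by omega⟩
    refine le_trans (le_of_eq ?_) h
    simp [h2, h3]
    ring
end
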